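/- arXiv:1003.4179 — 3 statements merged into one kernel-verified Lean document; each statement's English description precedes it below -/
import Mathlib

section
/- Let (E,d) be a complete geodesic metric space and let X and Y be nonempty, bounded and closed subsets of E. Then the minimization problem min(X,Y) is well-posed if and only if inf_{σ>0} diam L_{XY}(σ) = 0 and inf_{σ>0} diam L_{YX}(σ) = 0; and the maximization problem max(X,Y) is well-posed if and only if inf_{σ>0} diam M_{XY}(σ) = 0 and inf_{σ>0} diam M_{YX}(σ) = 0. -/
open Metric Set Filter Bornology

noncomputable section

/-- A geodesic path of length `l`: a map `c : ℝ → E` that is isometric on `[0, l]`. -/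
def IsGeodesicPath {E : Type*} [MetricSpace E] (c : ℝ → E) (l : ℝ) : Prop :=
  0 ≤ l ∧ ∀ s ∈ Icc (0:ℝ) l, ∀ t ∈ Icc (0:ℝ) l, dist (c s) (c t) = |s - t|

/-- `S` is a geodesic segment joining `x` and `y`. -/
def IsGeodesicSegment {E : Type*} [MetricSpace E] (S : Set E) (x y : E) : Prop :=
  ∃ c l, IsGeodesicPath c l ∧ c 0 = x ∧ c l = y ∧ S = c '' Icc (0:ℝ) l

/-- A geodesic (line): an isometric image of `ℝ`. -/
def IsGeodesicLine {E : Type*} [MetricSpace E] (S : Set E) : Prop :=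
  ∃ c : ℝ → E, Isometry c ∧ S = Set.range c

/-- `E` is a geodesic space: every two points are joined by a geodesic path. -/
def IsGeodesicSpace (E : Type*) [MetricSpace E] : Prop :=
  ∀ x y : E, ∃ S, IsGeodesicSegment S x y

/-- `E` has the geodesic extension property: every geodesic segment is contained
in a geodesic. -/
def GeodesicExtensionProperty (E : Type*) [MetricSpace E] : Prop :=
  ∀ (S : Set E) (x y : E), IsGeodesicSegment S x y → ∃ L, IsGeodesicLine L ∧ S ⊆ L

/-- The metric of `E` is convex. -/
def HasConvexMetric (E : Type*) [MetricSpace E] : Prop :=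
  ∀ (c₁ c₂ : ℝ → E) (l₁ l₂ : ℝ), IsGeodesicPath c₁ l₁ → IsGeodesicPath c₂ l₂ →
    ∀ t ∈ Icc (0:ℝ) 1,
      dist (c₁ (t * l₁)) (c₂ (t * l₂)) ≤
        (1 - t) * dist (c₁ 0) (c₂ 0) + t * dist (c₁ l₁) (c₂ l₂)

/-- A subset `X` is (geodesically) convex: any geodesic segment joining two points
of `X` is contained in `X`. -/
def GeodesicConvex {E : Type*} [MetricSpace E] (X : Set E) : Prop :=
  ∀ x ∈ X, ∀ y ∈ X, ∀ S : Set E, IsGeodesicSegment S x y → S ⊆ X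

/-- A function `f : E → ℝ` is (geodesically) convex. -/
def GeodesicConvexFun {E : Type*} [MetricSpace E] (f : E → ℝ) : Prop :=
  ∀ (c : ℝ → E) (l : ℝ), IsGeodesicPath c l → ∀ t ∈ Icc (0:ℝ) 1,
    f (c (t * l)) ≤ (1 - t) * f (c 0) + t * f (c l)

/-- `G₁(S)`: the union of all geodesic segments with endpoints in `S`. -/
def geodSegUnion {E : Type*} [MetricSpace E] (S : Set E) : Set E :=
  {z | ∃ x ∈ S, ∃ y ∈ S, ∃ T : Set E, IsGeodesicSegment T x y ∧ z ∈ T}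

/-- The iterates `G_n(S)`. -/
def geodGn {E : Type*} [MetricSpace E] (S : Set E) : ℕ → Set E
  | 0 => S
  | n + 1 => geodSegUnion (geodGn S n)

/-- The (geodesic) convex hull `co(S) = ⋃ₙ G_n(S)`. -/
def geodConvexHull {E : Type*} [MetricSpace E] (S : Set E) : Set E :=
  ⋃ n, geodGn S n

/-- `E` is without bifurcating geodesics. -/
def NoBifurcatingGeodesics (E : Type*) [MetricSpace E] : Prop :=
  ∀ (p a b : E) (S₁ S₂ : Set E), IsGeodesicSegment S₁ p a → IsGeodesicSegment S₂ p b →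
    ∀ z, z ∈ S₁ → z ∈ S₂ → z ≠ p → (z = a ∧ z = b) ∨ S₁ ⊆ S₂ ∨ S₂ ⊆ S₁

/-- `E` is reflexive: every descending sequence of nonempty, bounded, closed and convex
subsets of `E` has nonempty intersection. -/
def ReflexiveGeodesicSpace (E : Type*) [MetricSpace E] : Prop :=
  ∀ C : ℕ → Set E, (∀ n, (C n).Nonempty) → (∀ n, IsBounded (C n)) → (∀ n, IsClosed (C n)) →
    (∀ n, GeodesicConvex (C n)) → (∀ n, C (n + 1) ⊆ C n) → (⋂ n, C n).Nonempty

/-- `Dist(x, A)`: the remotal (farthest) distance from `x` to `A`. -/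
def supDist {E : Type*} [MetricSpace E] (x : E) (A : Set E) : ℝ :=
  sSup ((fun a => dist x a) '' A)

/-- `λ_{XY} = inf{ d(x,y) : x ∈ X, y ∈ Y }`. -/
def infSetDist {E : Type*} [MetricSpace E] (X Y : Set E) : ℝ :=
  sInf (Set.image2 dist X Y)

/-- `μ_{XY} = sup{ d(x,y) : x ∈ X, y ∈ Y }`. -/
def supSetDist {E : Type*} [MetricSpace E] (X Y : Set E) : ℝ :=
  sSup (Set.image2 dist X Y)

/-- `L_{XY}(σ) = { x ∈ X : dist(x,Y) ≤ λ_{XY} + σ }`. -/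
def Lset {E : Type*} [MetricSpace E] (X Y : Set E) (σ : ℝ) : Set E :=
  {x ∈ X | infDist x Y ≤ infSetDist X Y + σ}

/-- `M_{XY}(σ) = { x ∈ X : Dist(x,Y) ≥ μ_{XY} − σ }`. -/
def Mset {E : Type*} [MetricSpace E] (X Y : Set E) (σ : ℝ) : Set E :=
  {x ∈ X | supSetDist X Y - σ ≤ supDist x Y}

/-- The minimization problem `min(X,Y)` is well-posed. -/
def MinWellPosed {E : Type*} [MetricSpace E] (X Y : Set E) : Prop :=
  ∃ x₀ ∈ X, ∃ y₀ ∈ Y, dist x₀ y₀ = infSetDist X Y ∧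
    (∀ x ∈ X, ∀ y ∈ Y, dist x y = infSetDist X Y → x = x₀ ∧ y = y₀) ∧
    ∀ x : ℕ → E, ∀ y : ℕ → E, (∀ n, x n ∈ X) → (∀ n, y n ∈ Y) →
      Tendsto (fun n => dist (x n) (y n)) atTop (nhds (infSetDist X Y)) →
      Tendsto x atTop (nhds x₀) ∧ Tendsto y atTop (nhds y₀)

/-- The maximization problem `max(X,Y)` is well-posed. -/
def MaxWellPosed {E : Type*} [MetricSpace E] (X Y : Set E) : Prop :=
  ∃ x₀ ∈ X, ∃ y₀ ∈ Y, dist x₀ y₀ = supSetDist X Y ∧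
    (∀ x ∈ X, ∀ y ∈ Y, dist x y = supSetDist X Y → x = x₀ ∧ y = y₀) ∧
    ∀ x : ℕ → E, ∀ y : ℕ → E, (∀ n, x n ∈ X) → (∀ n, y n ∈ Y) →
      Tendsto (fun n => dist (x n) (y n)) atTop (nhds (supSetDist X Y)) →
      Tendsto x atTop (nhds x₀) ∧ Tendsto y atTop (nhds y₀)

/-- The distance of the model space `M²_κ` (κ < 0): the hyperbolic distance
multiplied by `1/√(-κ)`. -/
def kdist (κ : ℝ) (a b : UpperHalfPlane) : ℝ :=
  (Real.sqrt (-κ))⁻¹ * dist a b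

/-- `pb` is the comparison point in `M²_κ` (relative to the side from `xi` to `xj`,
with comparison vertices `xib`, `xjb`) of a point `p` on a geodesic segment from
`xi` to `xj`. -/
def IsComparisonPoint {E : Type*} [MetricSpace E] (κ : ℝ) (xi xj : E)
    (xib xjb : UpperHalfPlane) (p : E) (pb : UpperHalfPlane) : Prop :=
  kdist κ xib pb = dist xi p ∧ kdist κ pb xjb = dist p xj

/-- `E` has curvature bounded below by `κ < 0`: every geodesic triangle satisfies the
reversed CAT(κ) inequality with respect to any κ-comparison triangle in `M²_κ`. -/
def CurvBoundedBelow (E : Type*) [MetricSpace E] (κ : ℝ) : Prop :=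
  ∀ (x₁ x₂ x₃ : E) (S₁₂ S₂₃ S₁₃ : Set E),
    IsGeodesicSegment S₁₂ x₁ x₂ → IsGeodesicSegment S₂₃ x₂ x₃ → IsGeodesicSegment S₁₃ x₁ x₃ →
    ∀ x₁b x₂b x₃b : UpperHalfPlane,
      kdist κ x₁b x₂b = dist x₁ x₂ → kdist κ x₂b x₃b = dist x₂ x₃ →
      kdist κ x₁b x₃b = dist x₁ x₃ →
      ∀ (p q : E) (pb qb : UpperHalfPlane),
        ((p ∈ S₁₂ ∧ IsComparisonPoint κ x₁ x₂ x₁b x₂b p pb) ∨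
         (p ∈ S₂₃ ∧ IsComparisonPoint κ x₂ x₃ x₂b x₃b p pb) ∨
         (p ∈ S₁₃ ∧ IsComparisonPoint κ x₁ x₃ x₁b x₃b p pb)) →
        ((q ∈ S₁₂ ∧ IsComparisonPoint κ x₁ x₂ x₁b x₂b q qb) ∨
         (q ∈ S₂₃ ∧ IsComparisonPoint κ x₂ x₃ x₂b x₃b q qb) ∨
         (q ∈ S₁₃ ∧ IsComparisonPoint κ x₁ x₃ x₁b x₃b q qb)) →
        kdist κ pb qb ≤ dist p q

/-- Comparison points for Euclidean (κ = 0) comparison triangles in `ℝ²`. -/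
def IsComparisonPointE {E : Type*} [MetricSpace E] (xi xj : E)
    (xib xjb : EuclideanSpace ℝ (Fin 2)) (p : E) (pb : EuclideanSpace ℝ (Fin 2)) : Prop :=
  dist xib pb = dist xi p ∧ dist pb xjb = dist p xj

/-- `E` is a CAT(0) space: a geodesic space where every geodesic triangle satisfies the
CAT(0) comparison inequality with respect to Euclidean comparison triangles. -/
def CATZero (E : Type*) [MetricSpace E] : Prop :=
  IsGeodesicSpace E ∧
  ∀ (x₁ x₂ x₃ : E) (S₁₂ S₂₃ S₁₃ : Set E),
    IsGeodesicSegment S₁₂ x₁ x₂ → IsGeodesicSegment S₂₃ x₂ x₃ → IsGeodesicSegment S₁₃ x₁ x₃ →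
    ∀ x₁b x₂b x₃b : EuclideanSpace ℝ (Fin 2),
      dist x₁b x₂b = dist x₁ x₂ → dist x₂b x₃b = dist x₂ x₃ → dist x₁b x₃b = dist x₁ x₃ →
      ∀ (p q : E) (pb qb : EuclideanSpace ℝ (Fin 2)),
        ((p ∈ S₁₂ ∧ IsComparisonPointE x₁ x₂ x₁b x₂b p pb) ∨
         (p ∈ S₂₃ ∧ IsComparisonPointE x₂ x₃ x₂b x₃b p pb) ∨
         (p ∈ S₁₃ ∧ IsComparisonPointE x₁ x₃ x₁b x₃b p pb)) →
        ((q ∈ S₁₂ ∧ IsComparisonPointE x₁ x₂ x₁b x₂b q qb) ∨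
         (q ∈ S₂₃ ∧ IsComparisonPointE x₂ x₃ x₂b x₃b q qb) ∨
         (q ∈ S₁₃ ∧ IsComparisonPointE x₁ x₃ x₁b x₃b q qb)) →
        dist p q ≤ dist pb qb

/-- The space `P_{b,cl,cv}(E)` of nonempty, bounded, closed and convex subsets of `E`. -/
def Pbclcv (E : Type*) [MetricSpace E] : Type _ :=
  {X : Set E // X.Nonempty ∧ IsBounded X ∧ IsClosed X ∧ GeodesicConvex X}

/-- `P_{b,cl,cv}(E)` carries the Pompeiu-Hausdorff distance. -/
instance Pbclcv.metricSpace (E : Type*) [MetricSpace E] : MetricSpace (Pbclcv E) where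
  dist X Y := hausdorffDist X.1 Y.1
  dist_self X := hausdorffDist_self_zero
  dist_comm X Y := hausdorffDist_comm
  dist_triangle X Y Z := hausdorffDist_triangle
    (hausdorffEdist_ne_top_of_nonempty_of_bounded X.2.1 Y.2.1 X.2.2.1 Y.2.2.1)
  eq_of_dist_eq_zero := by
    intro X Y h
    exact Subtype.ext ((X.2.2.2.1.hausdorffDist_zero_iff_eq Y.2.2.2.1
      (hausdorffEdist_ne_top_of_nonempty_of_bounded X.2.1 Y.2.1 X.2.2.1 Y.2.2.1)).mp h)

/-- `P^A_{b,cl,cv}(E)`: the closure in `(P_{b,cl,cv}(E), h)` of the family of sets at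
positive distance from `A`. -/
def PAbclcv {E : Type*} [MetricSpace E] (A : Set E) : Set (Pbclcv E) :=
  closure {X : Pbclcv E | 0 < infSetDist X.1 A}

/-- The inverse hyperbolic cosine. -/
def arcosh (x : ℝ) : ℝ := Real.log (x + Real.sqrt (x ^ 2 - 1))

/-- The function `F_κ`. -/
def Fkappa (κ d r σ : ℝ) : ℝ :=
  2 / Real.sqrt (-κ) *
    arcosh (Real.cosh (Real.sqrt (-κ) * (r - d + σ)) ^ 2 -
      Real.sinh (Real.sqrt (-κ) * (r - d + σ)) / Real.sinh (Real.sqrt (-κ) * d) *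
        (Real.cosh (Real.sqrt (-κ) * r) -
          Real.cosh (Real.sqrt (-κ) * d) * Real.cosh (Real.sqrt (-κ) * (r - d + σ))))

/-- The petal `P_{α,δ}(x₀, f)`. -/
def petal {E : Type*} [MetricSpace E] (f : E → ℝ) (α δ : ℝ) (x₀ : E) : Set E :=
  {x | f x ≤ f x₀ - α * dist x x₀ + δ}

/-- `L_{A,f}(σ)`. -/
def LsetFun {E : Type*} [MetricSpace E] (A : Set E) (f : E → ℝ) (σ : ℝ) : Set E :=
  {x | f x ≤ sInf (f '' A) + σ ∧ infDist x A ≤ σ}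

/-- The problem `min(A,f)` is well-posed in the sense of Revalski. -/
def RevalskiWellPosed {E : Type*} [MetricSpace E] (A : Set E) (f : E → ℝ) : Prop :=
  sInf ((fun σ => diam (LsetFun A f σ)) '' Ioi 0) = 0

/-- The nearest point problem `min(X,y)` is well-posed. -/
def PointMinWellPosed {E : Type*} [MetricSpace E] (X : Set E) (y : E) : Prop :=
  ∃ x₀ ∈ X, dist x₀ y = infDist y X ∧ (∀ x ∈ X, dist x y = infDist y X → x = x₀) ∧
    ∀ x : ℕ → E, (∀ n, x n ∈ X) →
      Tendsto (fun n => dist (x n) y) atTop (nhds (infDist y X)) →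
      Tendsto x atTop (nhds x₀)

end

section WellPosedness

variable {E : Type*} [MetricSpace E]

theorem sInf_diam_eq_zero_iff {A : ℝ → Set E} (hb : ∀ σ, IsBounded (A σ)) :
    sInf ((fun σ => diam (A σ)) '' Ioi 0) = 0 ↔
      ∀ ε > 0, ∃ σ > 0, ∀ x ∈ A σ, ∀ y ∈ A σ, dist x y < ε := by
  have hne : ((fun σ => diam (A σ)) '' Ioi 0).Nonempty := nonempty_Ioi.image _
  constructor
  · intro h ε hε
    obtain ⟨_, ⟨σ, hσ, rfl⟩, hlt⟩ := exists_lt_of_csInf_lt hne (h.trans_lt hε)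
    exact ⟨σ, hσ, fun x hx y hy => (dist_le_diam_of_mem (hb σ) hx hy).trans_lt hlt⟩
  · intro h
    refine le_antisymm (le_of_forall_pos_le_add fun ε hε => ?_)
      (Real.sInf_nonneg (by rintro _ ⟨σ, -, rfl⟩; exact diam_nonneg))
    obtain ⟨σ, hσ, hd⟩ := h ε hε
    rw [zero_add]
    exact (csInf_le ⟨0, by rintro _ ⟨σ, -, rfl⟩; exact diam_nonneg⟩
      (mem_image_of_mem (fun σ => diam (A σ)) hσ)).trans
      (diam_le_of_forall_dist_le hε.le fun x hx y hy => (hd x hx y hy).le)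

/-- If approximate solutions converge to `x₀`, then the sets of `σ`-approximate solutions
shrink to a point. -/
theorem exists_forall_dist_lt_of_tendsto {Y : Set E} {g : E → E → ℝ} {A : ℝ → Set E} {x₀ : E}
    (hA : ∀ σ > 0, ∀ x ∈ A σ, ∃ y ∈ Y, |g x y| ≤ 2 * σ)
    (hlim : ∀ u v : ℕ → E, (∀ n, ∃ σ, u n ∈ A σ) → (∀ n, v n ∈ Y) →
      Tendsto (fun n => g (u n) (v n)) atTop (nhds 0) → Tendsto u atTop (nhds x₀))
    {ε : ℝ} (hε : 0 < ε) :
    ∃ σ > 0, ∀ x ∈ A σ, ∀ y ∈ A σ, dist x y < ε := by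
  suffices h : ∃ σ > 0, ∀ x ∈ A σ, dist x x₀ < ε / 2 by
    obtain ⟨σ, hσ, h⟩ := h
    exact ⟨σ, hσ, fun x hx y hy => by
      linarith [dist_triangle_right x y x₀, h x hx, h y hy]⟩
  by_contra! hcon
  choose u huA hu using fun n : ℕ => hcon (1 / ((n : ℝ) + 1)) (by positivity)
  choose v hvY hv using fun n => hA _ (by positivity) (u n) (huA n)
  have hg : Tendsto (fun n => g (u n) (v n)) atTop (nhds 0) := by
    refine squeeze_zero_norm hv ?_
    simpa using tendsto_one_div_add_atTop_nhds_zero_nat.const_mul (2 : ℝ)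
  obtain ⟨n, hn⟩ :=
    ((hlim u v (fun n => ⟨_, huA n⟩) hvY hg).eventually (ball_mem_nhds x₀ (half_pos hε))).exists
  exact absurd hn (not_lt.2 (hu n))

theorem cauchySeq_of_eventually_mem {A : ℝ → Set E}
    (hA : ∀ ε > 0, ∃ σ > 0, ∀ x ∈ A σ, ∀ y ∈ A σ, dist x y < ε) {u : ℕ → E}
    (hu : ∀ σ > 0, ∀ᶠ n in atTop, u n ∈ A σ) : CauchySeq u := by
  refine Metric.cauchySeq_iff.2 fun ε hε => ?_
  obtain ⟨σ, hσ, h⟩ := hA ε hε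
  obtain ⟨N, hN⟩ := eventually_atTop.1 (hu σ hσ)
  exact ⟨N, fun m hm n hn => h _ (hN m hm) _ (hN n hn)⟩

theorem tendsto_of_eventually_mem {A : ℝ → Set E}
    (hA : ∀ ε > 0, ∃ σ > 0, ∀ x ∈ A σ, ∀ y ∈ A σ, dist x y < ε) {u : ℕ → E} {x₀ : E}
    (hu : ∀ σ > 0, ∀ᶠ n in atTop, u n ∈ A σ) (hx₀ : ∀ σ > 0, x₀ ∈ A σ) :
    Tendsto u atTop (nhds x₀) := by
  refine Metric.tendsto_nhds.2 fun ε hε => ?_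
  obtain ⟨σ, hσ, h⟩ := hA ε hε
  exact (hu σ hσ).mono fun n hn => h _ hn _ (hx₀ σ hσ)

theorem eq_of_forall_mem {A : ℝ → Set E}
    (hA : ∀ ε > 0, ∃ σ > 0, ∀ x ∈ A σ, ∀ y ∈ A σ, dist x y < ε) {x y : E}
    (hx : ∀ σ > 0, x ∈ A σ) (hy : ∀ σ > 0, y ∈ A σ) : x = y :=
  eq_of_forall_dist_le fun ε hε => by
    obtain ⟨σ, hσ, h⟩ := hA ε hε
    exact (h x (hx σ hσ) y (hy σ hσ)).le

/-- Well-posedness of the problem of making `|g|` vanish on `X × Y`, characterized by the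
diameters of families `A`, `B` of approximate solutions. -/
theorem wellPosed_iff_sInf_diam [CompleteSpace E] {X Y : Set E} {g : E → E → ℝ}
    {A B : ℝ → Set E} (hXb : IsBounded X) (hXc : IsClosed X) (hYb : IsBounded Y)
    (hYc : IsClosed Y) (hg : Continuous fun p : E × E => g p.1 p.2)
    (hAX : ∀ σ, A σ ⊆ X) (hBY : ∀ σ, B σ ⊆ Y)
    (hex : ∀ σ > 0, ∃ x ∈ X, ∃ y ∈ Y, |g x y| ≤ σ)
    (hmem : ∀ x ∈ X, ∀ y ∈ Y, ∀ σ, |g x y| ≤ σ → x ∈ A σ ∧ y ∈ B σ)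
    (hA : ∀ σ > 0, ∀ x ∈ A σ, ∃ y ∈ Y, |g x y| ≤ 2 * σ)
    (hB : ∀ σ > 0, ∀ y ∈ B σ, ∃ x ∈ X, |g x y| ≤ 2 * σ) :
    (∃ x₀ ∈ X, ∃ y₀ ∈ Y, g x₀ y₀ = 0 ∧
      (∀ x ∈ X, ∀ y ∈ Y, g x y = 0 → x = x₀ ∧ y = y₀) ∧
      ∀ x : ℕ → E, ∀ y : ℕ → E, (∀ n, x n ∈ X) → (∀ n, y n ∈ Y) →
        Tendsto (fun n => g (x n) (y n)) atTop (nhds 0) →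
        Tendsto x atTop (nhds x₀) ∧ Tendsto y atTop (nhds y₀)) ↔
      sInf ((fun σ => diam (A σ)) '' Ioi 0) = 0 ∧
      sInf ((fun σ => diam (B σ)) '' Ioi 0) = 0 := by
  rw [sInf_diam_eq_zero_iff fun σ => hXb.subset (hAX σ),
    sInf_diam_eq_zero_iff fun σ => hYb.subset (hBY σ)]
  constructor
  · rintro ⟨x₀, -, y₀, -, -, -, hlim⟩
    exact ⟨fun ε hε => exists_forall_dist_lt_of_tendsto hA
        (fun u v hu hv h =>
          (hlim u v (fun n => (hu n).elim fun σ hσ => hAX σ hσ) hv h).1) hε,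
      fun ε hε => exists_forall_dist_lt_of_tendsto (g := fun y x => g x y) hB
        (fun v u hv hu h =>
          (hlim u v hu (fun n => (hv n).elim fun σ hσ => hBY σ hσ) h).2) hε⟩
  · rintro ⟨hdA, hdB⟩
    have hev : ∀ u v : ℕ → E, (∀ n, u n ∈ X) → (∀ n, v n ∈ Y) →
        Tendsto (fun n => g (u n) (v n)) atTop (nhds 0) →
        ∀ σ > 0, ∀ᶠ n in atTop, u n ∈ A σ ∧ v n ∈ B σ := by
      intro u v hu hv h σ hσ
      filter_upwards [Metric.tendsto_nhds.1 h σ hσ] with n hn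
      rw [Real.dist_0_eq_abs] at hn
      exact hmem _ (hu n) _ (hv n) σ hn.le
    have hzero : ∀ x ∈ X, ∀ y ∈ Y, g x y = 0 → ∀ σ > 0, x ∈ A σ ∧ y ∈ B σ :=
      fun x hx y hy h σ hσ => hmem x hx y hy σ (by simpa [h] using hσ.le)
    choose u huX v hvY huv using fun n : ℕ => hex (1 / ((n : ℝ) + 1)) (by positivity)
    have hlim : Tendsto (fun n => g (u n) (v n)) atTop (nhds 0) :=
      squeeze_zero_norm huv tendsto_one_div_add_atTop_nhds_zero_nat
    have huvmem := hev u v huX hvY hlim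
    obtain ⟨x₀, hx₀⟩ := cauchySeq_tendsto_of_complete
      (cauchySeq_of_eventually_mem hdA fun σ hσ => (huvmem σ hσ).mono fun _ h => h.1)
    obtain ⟨y₀, hy₀⟩ := cauchySeq_tendsto_of_complete
      (cauchySeq_of_eventually_mem hdB fun σ hσ => (huvmem σ hσ).mono fun _ h => h.2)
    have hx₀X : x₀ ∈ X := hXc.mem_of_tendsto hx₀ (Eventually.of_forall huX)
    have hy₀Y : y₀ ∈ Y := hYc.mem_of_tendsto hy₀ (Eventually.of_forall hvY)
    have hg₀ : g x₀ y₀ = 0 :=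
      tendsto_nhds_unique ((hg.tendsto (x₀, y₀)).comp (hx₀.prodMk_nhds hy₀)) hlim
    have hmem₀ := hzero x₀ hx₀X y₀ hy₀Y hg₀
    refine ⟨x₀, hx₀X, y₀, hy₀Y, hg₀, fun x hx y hy h => ?_, fun x y hx hy h => ?_⟩
    · have hxy := hzero x hx y hy h
      exact ⟨eq_of_forall_mem hdA (fun σ hσ => (hxy σ hσ).1) fun σ hσ => (hmem₀ σ hσ).1,
        eq_of_forall_mem hdB (fun σ hσ => (hxy σ hσ).2) fun σ hσ => (hmem₀ σ hσ).2⟩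
    · have hxy := hev x y hx hy h
      exact ⟨tendsto_of_eventually_mem hdA (fun σ hσ => (hxy σ hσ).mono fun _ h => h.1)
          fun σ hσ => (hmem₀ σ hσ).1,
        tendsto_of_eventually_mem hdB (fun σ hσ => (hxy σ hσ).mono fun _ h => h.2)
          fun σ hσ => (hmem₀ σ hσ).2⟩

theorem infSetDist_comm (X Y : Set E) : infSetDist X Y = infSetDist Y X := by
  rw [infSetDist, infSetDist, image2_swap]
  simp only [dist_comm]

theorem supSetDist_comm (X Y : Set E) : supSetDist X Y = supSetDist Y X := by
  rw [supSetDist, supSetDist, image2_swap]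
  simp only [dist_comm]

theorem infSetDist_le_dist {X Y : Set E} {x y : E} (hx : x ∈ X) (hy : y ∈ Y) :
    infSetDist X Y ≤ dist x y :=
  csInf_le ⟨0, by rintro _ ⟨a, -, b, -, rfl⟩; exact dist_nonneg⟩ (mem_image2_of_mem hx hy)

theorem bddAbove_image2_dist {X Y : Set E} (hX : IsBounded X) (hY : IsBounded Y) :
    BddAbove (image2 dist X Y) := by
  obtain ⟨C, hC⟩ := Metric.isBounded_iff.1 (hX.union hY)
  exact ⟨C, by rintro _ ⟨a, ha, b, hb, rfl⟩; exact hC (Or.inl ha) (Or.inr hb)⟩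

theorem dist_le_supSetDist {X Y : Set E} (hX : IsBounded X) (hY : IsBounded Y) {x y : E}
    (hx : x ∈ X) (hy : y ∈ Y) : dist x y ≤ supSetDist X Y :=
  le_csSup (bddAbove_image2_dist hX hY) (mem_image2_of_mem hx hy)

theorem dist_le_supDist {Y : Set E} (hY : IsBounded Y) (x : E) {y : E} (hy : y ∈ Y) :
    dist x y ≤ supDist x Y := by
  refine le_csSup ?_ (mem_image_of_mem _ hy)
  simpa using bddAbove_image2_dist (isBounded_singleton (x := x)) hY

theorem mem_Lset_of_abs_le {X Y : Set E} {x y : E} {σ : ℝ} (hx : x ∈ X) (hy : y ∈ Y)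
    (h : |dist x y - infSetDist X Y| ≤ σ) : x ∈ Lset X Y σ :=
  ⟨hx, by linarith [infDist_le_dist_of_mem (x := x) hy, le_of_abs_le h]⟩

theorem exists_abs_le_of_mem_Lset {X Y : Set E} (hY : Y.Nonempty) {x : E} {σ : ℝ}
    (hσ : 0 < σ) (hx : x ∈ Lset X Y σ) :
    ∃ y ∈ Y, |dist x y - infSetDist X Y| ≤ 2 * σ := by
  obtain ⟨y, hy, hlt⟩ := (infDist_lt_iff hY (r := infSetDist X Y + 2 * σ)).1
    (by linarith [hx.2])
  exact ⟨y, hy, abs_le.2 ⟨by linarith [infSetDist_le_dist hx.1 hy], by linarith⟩⟩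

theorem mem_Mset_of_abs_le {X Y : Set E} (hYb : IsBounded Y) {x y : E} {σ : ℝ} (hx : x ∈ X)
    (hy : y ∈ Y) (h : |dist x y - supSetDist X Y| ≤ σ) : x ∈ Mset X Y σ :=
  ⟨hx, by linarith [dist_le_supDist hYb x hy, neg_le_of_abs_le h]⟩

theorem exists_abs_le_of_mem_Mset {X Y : Set E} (hXb : IsBounded X) (hY : Y.Nonempty)
    (hYb : IsBounded Y) {x : E} {σ : ℝ} (hσ : 0 < σ) (hx : x ∈ Mset X Y σ) :
    ∃ y ∈ Y, |dist x y - supSetDist X Y| ≤ 2 * σ := by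
  obtain ⟨_, ⟨y, hy, rfl⟩, hlt⟩ := exists_lt_of_lt_csSup (hY.image fun a => dist x a)
    (show supSetDist X Y - 2 * σ < supDist x Y by linarith [hx.2])
  exact ⟨y, hy, abs_le.2 ⟨by linarith, by linarith [dist_le_supSetDist hXb hYb hx.1 hy]⟩⟩

theorem exists_abs_dist_sub_infSetDist_le {X Y : Set E} (hX : X.Nonempty) (hY : Y.Nonempty)
    {σ : ℝ} (hσ : 0 < σ) : ∃ x ∈ X, ∃ y ∈ Y, |dist x y - infSetDist X Y| ≤ σ := by
  obtain ⟨_, ⟨x, hx, y, hy, rfl⟩, hlt⟩ := exists_lt_of_csInf_lt (hX.image2 hY)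
    (show infSetDist X Y < infSetDist X Y + σ by linarith)
  exact ⟨x, hx, y, hy, abs_le.2 ⟨by linarith [infSetDist_le_dist hx hy], by linarith⟩⟩

theorem exists_abs_dist_sub_supSetDist_le {X Y : Set E} (hX : X.Nonempty)
    (hXb : IsBounded X) (hY : Y.Nonempty) (hYb : IsBounded Y) {σ : ℝ} (hσ : 0 < σ) :
    ∃ x ∈ X, ∃ y ∈ Y, |dist x y - supSetDist X Y| ≤ σ := by
  obtain ⟨_, ⟨x, hx, y, hy, rfl⟩, hlt⟩ := exists_lt_of_lt_csSup (hX.image2 hY)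
    (show supSetDist X Y - σ < supSetDist X Y by linarith)
  exact ⟨x, hx, y, hy,
    abs_le.2 ⟨by linarith, by linarith [dist_le_supSetDist hXb hYb hx hy]⟩⟩

theorem minWellPosed_iff [CompleteSpace E] {X Y : Set E}
    (hX : X.Nonempty) (hXb : IsBounded X) (hXc : IsClosed X)
    (hY : Y.Nonempty) (hYb : IsBounded Y) (hYc : IsClosed Y) :
    MinWellPosed X Y ↔
      sInf ((fun σ => diam (Lset X Y σ)) '' Ioi 0) = 0 ∧
      sInf ((fun σ => diam (Lset Y X σ)) '' Ioi 0) = 0 := by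
  have hswap : ∀ x y : E, dist y x - infSetDist Y X = dist x y - infSetDist X Y := fun x y => by
    rw [dist_comm, infSetDist_comm]
  rw [← wellPosed_iff_sInf_diam (g := fun x y => dist x y - infSetDist X Y) hXb hXc hYb hYc
    (by fun_prop) (fun σ _ h => h.1) (fun σ _ h => h.1)
    (fun σ hσ => exists_abs_dist_sub_infSetDist_le hX hY hσ)
    (fun x hx y hy σ h => ⟨mem_Lset_of_abs_le hx hy h,
      mem_Lset_of_abs_le hy hx (by rwa [hswap])⟩)
    (fun σ hσ x hx => exists_abs_le_of_mem_Lset hY hσ hx)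
    (fun σ hσ y hy => by simpa only [hswap] using exists_abs_le_of_mem_Lset hX hσ hy)]
  simp only [MinWellPosed, sub_eq_zero, tendsto_sub_nhds_zero_iff]

theorem maxWellPosed_iff [CompleteSpace E] {X Y : Set E}
    (hX : X.Nonempty) (hXb : IsBounded X) (hXc : IsClosed X)
    (hY : Y.Nonempty) (hYb : IsBounded Y) (hYc : IsClosed Y) :
    MaxWellPosed X Y ↔
      sInf ((fun σ => diam (Mset X Y σ)) '' Ioi 0) = 0 ∧
      sInf ((fun σ => diam (Mset Y X σ)) '' Ioi 0) = 0 := by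
  have hswap : ∀ x y : E, dist y x - supSetDist Y X = dist x y - supSetDist X Y := fun x y => by
    rw [dist_comm, supSetDist_comm]
  rw [← wellPosed_iff_sInf_diam (g := fun x y => dist x y - supSetDist X Y) hXb hXc hYb hYc
    (by fun_prop) (fun σ _ h => h.1) (fun σ _ h => h.1)
    (fun σ hσ => exists_abs_dist_sub_supSetDist_le hX hXb hY hYb hσ)
    (fun x hx y hy σ h => ⟨mem_Mset_of_abs_le hYb hx hy h,
      mem_Mset_of_abs_le hXb hy hx (by rwa [hswap])⟩)
    (fun σ hσ x hx => exists_abs_le_of_mem_Mset hXb hY hYb hσ hx)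
    (fun σ hσ y hy => by simpa only [hswap] using exists_abs_le_of_mem_Mset hYb hX hXb hσ hy)]
  simp only [MaxWellPosed, sub_eq_zero, tendsto_sub_nhds_zero_iff]

end WellPosedness

/-- Proposition: characterization of well-posedness. -/
theorem statement0 {E : Type*} [MetricSpace E] [CompleteSpace E]
    (hgeo : IsGeodesicSpace E) (X Y : Set E)
    (hX : X.Nonempty) (hXb : IsBounded X) (hXc : IsClosed X)
    (hY : Y.Nonempty) (hYb : IsBounded Y) (hYc : IsClosed Y) :
    (MinWellPosed X Y ↔
      sInf ((fun σ => diam (Lset X Y σ)) '' Ioi 0) = 0 ∧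
      sInf ((fun σ => diam (Lset Y X σ)) '' Ioi 0) = 0) ∧
    (MaxWellPosed X Y ↔
      sInf ((fun σ => diam (Mset X Y σ)) '' Ioi 0) = 0 ∧
      sInf ((fun σ => diam (Mset Y X σ)) '' Ioi 0) = 0) := by
  exact ⟨minWellPosed_iff hX hXb hXc hY hYb hYc, maxWellPosed_iff hX hXb hXc hY hYb hYc⟩
end

section
/- Let (E,d) be a geodesic space of curvature bounded below by κ<0, let x∈E, r>0, y∈B(x,r/2)∖{x} and 0 ≤ σ ≤ 2d(x,y), and suppose there exists u∈E on a geodesic passing through x and y such that d(x,u)=r and d(y,u)=r−d(x,y). Then diam D(x,y;r,σ) ≤ F_κ(d(x,y),r,σ) + 2σ, where D(x,y;r,σ) = B̃(y, r−d(x,y)+σ) ∖ B(x,r). -/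
open Metric Set Filter Bornology

/-- The point `exp t * I` of the upper half-plane. -/
noncomputable def verticalPoint (t : ℝ) : UpperHalfPlane :=
  ⟨⟨0, Real.exp t⟩, Real.exp_pos t⟩

lemma dist_verticalPoint (s t : ℝ) : dist (verticalPoint s) (verticalPoint t) = |s - t| := by
  rw [UpperHalfPlane.dist_of_re_eq (show (verticalPoint s).re = (verticalPoint t).re from rfl)]
  change dist (Real.log (Real.exp s)) (Real.log (Real.exp t)) = _
  rw [Real.log_exp, Real.log_exp, Real.dist_eq]

lemma cosh_dist_verticalPoint (z : UpperHalfPlane) (t : ℝ) :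
    Real.cosh (dist z (verticalPoint t)) =
      (z.re ^ 2 + z.im ^ 2) / (2 * z.im) * Real.exp (-t) + 1 / (2 * z.im) * Real.exp t := by
  have hz := z.im_pos
  have he := Real.exp_pos t
  rw [UpperHalfPlane.cosh_dist, Complex.dist_eq, Complex.sq_norm, Complex.normSq_apply]
  change 1 + ((z.re - 0) * (z.re - 0) + (z.im - Real.exp t) * (z.im - Real.exp t)) /
    (2 * z.im * Real.exp t) = _
  rw [Real.exp_neg]
  field_simp
  ring

/-- The triangle inequalities make the Gram-type determinant of three lengths nonnegative. -/
lemma sq_cosh_mul_cosh_sub_cosh_le {A C L : ℝ} (hA : 0 ≤ A) (hC : 0 ≤ C) (hL : 0 ≤ L)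
    (h₁ : A ≤ C + L) (h₂ : C ≤ A + L) (h₃ : L ≤ A + C) :
    (Real.cosh A * Real.cosh L - Real.cosh C) ^ 2 ≤ (Real.sinh A * Real.sinh L) ^ 2 := by
  have hlow : Real.cosh (A - L) ≤ Real.cosh C := by
    rw [Real.cosh_le_cosh, abs_of_nonneg hC, abs_le]
    constructor <;> linarith
  have hupp : Real.cosh C ≤ Real.cosh (A + L) := by
    rw [Real.cosh_le_cosh, abs_of_nonneg hC, abs_of_nonneg (by positivity)]
    exact h₂
  rw [Real.cosh_sub] at hlow
  rw [Real.cosh_add] at hupp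
  apply sq_le_sq' <;> linarith

/-- Existence of comparison triangles in the hyperbolic plane with one side on the imaginary axis,
together with the hyperbolic Stewart formula for the distances to that side. -/
lemma exists_cosh_dist_verticalPoint {A C L : ℝ} (hA : 0 ≤ A) (hC : 0 ≤ C) (hL : 0 < L)
    (h₁ : A ≤ C + L) (h₂ : C ≤ A + L) (h₃ : L ≤ A + C) :
    ∃ z : UpperHalfPlane, ∀ t, Real.sinh L * Real.cosh (dist z (verticalPoint t)) =
      Real.sinh (L - t) * Real.cosh A + Real.sinh t * Real.cosh C := by
  have hS : 0 < Real.sinh L := Real.sinh_pos_iff.2 hL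
  have hE : Real.exp L * Real.exp (-L) = 1 := by rw [← Real.exp_add]; simp
  have hnum : 0 < Real.cosh C - Real.exp (-L) * Real.cosh A := by
    have hle : Real.cosh A ≤ Real.cosh (C + L) := by
      rw [Real.cosh_le_cosh, abs_of_nonneg hA, abs_of_nonneg (by positivity)]
      exact h₁
    have hlt : Real.cosh (C + L) < Real.exp L * Real.cosh C := by
      have : Real.exp (-C) * Real.exp (-L) < Real.exp L * Real.exp (-C) := by
        rw [← Real.exp_add, ← Real.exp_add, Real.exp_lt_exp]
        linarith
      rw [Real.cosh_eq, Real.cosh_eq, neg_add, Real.exp_add, Real.exp_add]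
      linarith
    have := mul_lt_mul_of_pos_left (hle.trans_lt hlt) (Real.exp_pos (-L))
    have h : Real.exp (-L) * (Real.exp L * Real.cosh C) = Real.cosh C := by
      linear_combination Real.cosh C * hE
    linarith
  obtain ⟨w, hw⟩ : ∃ w, w = (Real.cosh C - Real.exp (-L) * Real.cosh A) / (2 * Real.sinh L) :=
    ⟨_, rfl⟩
  obtain ⟨n, hn⟩ : ∃ n, n = (Real.exp L * Real.cosh A - Real.cosh C) / (2 * Real.sinh L) :=
    ⟨_, rfl⟩
  have hw0 : 0 < w := by rw [hw]; positivity
  have hnw : 1 ≤ 4 * n * w := by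
    have hgram := sq_cosh_mul_cosh_sub_cosh_le hA hC hL.le h₁ h₂ h₃
    have heq : 4 * n * w = (Real.cosh C - Real.exp (-L) * Real.cosh A) *
        (Real.exp L * Real.cosh A - Real.cosh C) / Real.sinh L ^ 2 := by
      rw [hn, hw]; field_simp; ring
    rw [heq, le_div_iff₀ (by positivity), one_mul]
    have h2 : (Real.cosh C - Real.exp (-L) * Real.cosh A) *
        (Real.exp L * Real.cosh A - Real.cosh C) =
        2 * Real.cosh L * Real.cosh A * Real.cosh C - Real.cosh C ^ 2 - Real.cosh A ^ 2 := by
      rw [Real.cosh_eq L]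
      linear_combination (-Real.cosh A ^ 2) * hE
    rw [h2]
    rw [mul_pow, Real.sinh_sq A] at hgram
    have := Real.cosh_sq L
    nlinarith
  have hq : 0 ≤ n / w - (1 / (2 * w)) ^ 2 := by
    have : n / w - (1 / (2 * w)) ^ 2 = (4 * n * w - 1) / (4 * w ^ 2) := by
      field_simp; ring
    rw [this]
    exact div_nonneg (by linarith) (by positivity)
  refine ⟨⟨⟨√(n / w - (1 / (2 * w)) ^ 2), 1 / (2 * w)⟩, by change 0 < 1 / (2 * w); positivity⟩,
    fun t => ?_⟩
  rw [cosh_dist_verticalPoint]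
  change Real.sinh L * ((√(n / w - (1 / (2 * w)) ^ 2) ^ 2 + (1 / (2 * w)) ^ 2) /
    (2 * (1 / (2 * w))) * Real.exp (-t) + 1 / (2 * (1 / (2 * w))) * Real.exp t) = _
  rw [Real.sq_sqrt hq]
  have hcoef : (n / w - (1 / (2 * w)) ^ 2 + (1 / (2 * w)) ^ 2) / (2 * (1 / (2 * w))) = n := by
    field_simp; ring
  have hcoef' : 1 / (2 * (1 / (2 * w))) = w := by field_simp
  rw [hcoef, hcoef']
  have hwS : 2 * Real.sinh L * w = Real.cosh C - Real.exp (-L) * Real.cosh A := by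
    rw [hw]; field_simp
  have hnS : 2 * Real.sinh L * n = Real.exp L * Real.cosh A - Real.cosh C := by
    rw [hn]; field_simp
  rw [Real.sinh_eq (L - t), Real.sinh_eq t, neg_sub, sub_eq_add_neg L t, sub_eq_add_neg t L,
    Real.exp_add, Real.exp_add]
  linear_combination (Real.exp t / 2) * hwS + (Real.exp (-t) / 2) * hnS

/-- `arcosh` is an upper bound for nonnegative reals whose `cosh` is bounded. -/
lemma le_arcosh_of_cosh_le {a X : ℝ} (ha : 0 ≤ a) (h : Real.cosh a ≤ X) : a ≤ arcosh X := by
  have hs : 0 ≤ Real.sinh a := Real.sinh_nonneg_iff.2 ha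
  have hX : Real.sinh a ≤ √(X ^ 2 - 1) := by
    apply Real.le_sqrt_of_sq_le
    rw [Real.sinh_sq]
    have := pow_le_pow_left₀ (Real.cosh_pos a).le h 2
    linarith
  rw [arcosh, Real.le_log_iff_exp_le (by linarith [Real.cosh_pos a, Real.sqrt_nonneg (X ^ 2 - 1)]),
    ← Real.cosh_add_sinh]
  linarith

lemma isGeodesicSegment_image_of_isometry {E : Type*} [MetricSpace E] {p : ℝ → E}
    (hp : Isometry p) {l : ℝ} (hl : 0 ≤ l) :
    IsGeodesicSegment (p '' Icc (0 : ℝ) l) (p 0) (p l) :=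
  ⟨p, l, ⟨hl, fun s _ t _ => by rw [hp.dist_eq, Real.dist_eq]⟩, rfl, rfl, rfl⟩

lemma IsGeodesicSegment.right_mem {E : Type*} [MetricSpace E] {S : Set E} {x y : E}
    (h : IsGeodesicSegment S x y) : y ∈ S := by
  obtain ⟨c, l, hc, -, rfl, rfl⟩ := h
  exact mem_image_of_mem c (right_mem_Icc.2 hc.1)

/-- Three points of a geodesic line, the second one lying between the other two, admit a common
arc-length parametrization starting at the first one. -/
lemma IsGeodesicLine.exists_isometry {E : Type*} [MetricSpace E] {L : Set E}
    (hL : IsGeodesicLine L) {x y u : E} (hx : x ∈ L) (hy : y ∈ L) (hu : u ∈ L) (hyx : y ≠ x)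
    (h : dist x u = dist x y + dist y u) :
    ∃ p : ℝ → E, Isometry p ∧ p 0 = x ∧ p (dist x y) = y ∧ p (dist x u) = u := by
  obtain ⟨c, hc, rfl⟩ := hL
  obtain ⟨a, rfl⟩ := hx
  obtain ⟨b, rfl⟩ := hy
  obtain ⟨e, rfl⟩ := hu
  simp only [hc.dist_eq, Real.dist_eq] at h ⊢
  have hab : a ≠ b := fun hab => hyx (by rw [hab])
  rcases lt_or_gt_of_ne hab with hlt | hlt
  · have hbe : b ≤ e := by
      rw [abs_of_neg (sub_neg.2 hlt)] at h
      by_contra! hcon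
      rw [abs_of_pos (sub_pos.2 hcon)] at h
      rcases abs_cases (a - e) with h' | h' <;> linarith
    refine ⟨fun t => c (a + t), hc.comp (isometry_add_left a), by simp, ?_, ?_⟩
    · rw [abs_of_neg (sub_neg.2 hlt)]; exact congrArg c (by ring)
    · rw [abs_of_neg (by linarith)]; exact congrArg c (by ring)
  · have hbe : e ≤ b := by
      rw [abs_of_pos (sub_pos.2 hlt)] at h
      by_contra! hcon
      rw [abs_of_neg (sub_neg.2 hcon)] at h
      rcases abs_cases (a - e) with h' | h' <;> linarith
    refine ⟨fun t => c (a - t), hc.comp ?_, by simp, ?_, ?_⟩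
    · exact Isometry.of_dist_eq fun s t => by
        rw [Real.dist_eq, Real.dist_eq, abs_sub_comm s t]; congr 1; ring
    · rw [abs_of_pos (sub_pos.2 hlt)]; exact congrArg c (by ring)
    · rw [abs_of_nonneg (by linarith)]; exact congrArg c (by ring)

/-- The Stewart-type inequality in curvature bounded below by `κ`, for a point dividing a side of
a geodesic triangle. -/
lemma CurvBoundedBelow.stewart_le {E : Type*} [MetricSpace E] (hgeo : IsGeodesicSpace E)
    {κ : ℝ} (hκ : κ < 0) (hcurv : CurvBoundedBelow E κ) {p : ℝ → E} (hp : Isometry p)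
    {d l : ℝ} (hd : 0 ≤ d) (hdl : d ≤ l) (hl : 0 < l) (z : E) :
    Real.sinh (√(-κ) * (l - d)) * Real.cosh (√(-κ) * dist (p 0) z) +
        Real.sinh (√(-κ) * d) * Real.cosh (√(-κ) * dist (p l) z) ≤
      Real.sinh (√(-κ) * l) * Real.cosh (√(-κ) * dist (p d) z) := by
  have hk : 0 < √(-κ) := Real.sqrt_pos.2 (neg_pos.2 hκ)
  set k := √(-κ)
  have hdist : ∀ s t, dist (p s) (p t) = |s - t| := fun s t => by rw [hp.dist_eq, Real.dist_eq]
  have h0l : dist (p 0) (p l) = l := by rw [hdist, zero_sub, abs_neg, abs_of_pos hl]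
  have hscale : ∀ {a b c : ℝ}, a ≤ b + c → k * a ≤ k * b + k * c := fun h => by
    rw [← mul_add]; exact mul_le_mul_of_nonneg_left h hk.le
  have hS : 0 < Real.sinh (k * l) := Real.sinh_pos_iff.2 (mul_pos hk hl)
  obtain ⟨zb, hzb⟩ := exists_cosh_dist_verticalPoint
    (A := k * dist (p 0) z) (C := k * dist (p l) z) (L := k * l) (by positivity) (by positivity)
    (by positivity)
    (hscale (by linarith [dist_triangle (p 0) (p l) z]))
    (hscale (by linarith [dist_triangle (p l) (p 0) z, dist_comm (p l) (p 0)]))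
    (hscale (by linarith [dist_triangle (p 0) z (p l), dist_comm z (p l)]))
  have hinj : ∀ {a b : ℝ}, 0 ≤ a → 0 ≤ b →
      Real.sinh (k * l) * Real.cosh a = Real.sinh (k * l) * Real.cosh b → a = b :=
    fun ha hb hab => Real.cosh_strictMonoOn.injOn ha hb (mul_left_cancel₀ hS.ne' hab)
  have hz0 : dist zb (verticalPoint (k * 0)) = k * dist (p 0) z :=
    hinj dist_nonneg (by positivity) (by rw [hzb]; simp)
  have hzl : dist zb (verticalPoint (k * l)) = k * dist (p l) z :=
    hinj dist_nonneg (by positivity) (by rw [hzb]; simp)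
  have hvert : ∀ s t, kdist κ (verticalPoint (k * s)) (verticalPoint (k * t)) =
      dist (p s) (p t) := fun s t => by
    rw [kdist, dist_verticalPoint, hdist, ← mul_sub, abs_mul, abs_of_pos hk]
    exact inv_mul_cancel_left₀ hk.ne' _
  have hk0 : kdist κ (verticalPoint (k * 0)) zb = dist (p 0) z := by
    rw [kdist, dist_comm, hz0]; exact inv_mul_cancel_left₀ hk.ne' _
  have hkl : kdist κ (verticalPoint (k * l)) zb = dist (p l) z := by
    rw [kdist, dist_comm, hzl]; exact inv_mul_cancel_left₀ hk.ne' _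
  obtain ⟨S₂₃, hS₂₃⟩ := hgeo (p l) z
  obtain ⟨S₁₃, hS₁₃⟩ := hgeo (p 0) z
  have hcomp : kdist κ (verticalPoint (k * d)) zb ≤ dist (p d) z :=
    hcurv _ _ _ _ _ _ (isGeodesicSegment_image_of_isometry hp hl.le) hS₂₃ hS₁₃ _ _ _
      (hvert 0 l) hkl hk0 (p d) z _ _
      (Or.inl ⟨mem_image_of_mem p ⟨hd, hdl⟩, hvert 0 d, hvert d l⟩)
      (Or.inr (Or.inr ⟨hS₁₃.right_mem, hk0, by simp [kdist]⟩))
  have hle : dist zb (verticalPoint (k * d)) ≤ k * dist (p d) z := by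
    rw [kdist, inv_mul_le_iff₀ hk, dist_comm] at hcomp
    exact hcomp
  rw [mul_sub, ← hzb]
  refine mul_le_mul_of_nonneg_left ?_ hS.le
  rw [Real.cosh_le_cosh, abs_of_nonneg dist_nonneg, abs_of_nonneg (by positivity)]
  exact hle

/-- Half of `Fkappa` bounds the distance from a point of the lune to the end `p (r + σ)` of the
geodesic. -/
lemma CurvBoundedBelow.two_mul_dist_le_Fkappa {E : Type*} [MetricSpace E]
    (hgeo : IsGeodesicSpace E) {κ : ℝ} (hκ : κ < 0) (hcurv : CurvBoundedBelow E κ)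
    {p : ℝ → E} (hp : Isometry p) {d r σ : ℝ} (hd : 0 < d) (hr : 0 ≤ r) (hR : 0 ≤ r - d + σ)
    {z : E} (hdz : dist (p d) z ≤ r - d + σ) (h0z : r ≤ dist (p 0) z) :
    2 * dist (p (r + σ)) z ≤ Fkappa κ d r σ := by
  have hk : 0 < √(-κ) := Real.sqrt_pos.2 (neg_pos.2 hκ)
  have hst := hcurv.stewart_le hgeo hκ hp hd.le (l := r + σ) (by linarith) (by linarith) z
  rw [Fkappa]
  set k := √(-κ)
  obtain ⟨R, hRdef⟩ : ∃ R, R = r - d + σ := ⟨_, rfl⟩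
  rw [← hRdef] at hR hdz ⊢
  rw [show r + σ - d = R by linarith] at hst
  have hSd : 0 < Real.sinh (k * d) := Real.sinh_pos_iff.2 (by positivity)
  have hSR : 0 ≤ Real.sinh (k * R) := Real.sinh_nonneg_iff.2 (by positivity)
  have hSl : 0 ≤ Real.sinh (k * (r + σ)) :=
    Real.sinh_nonneg_iff.2 (mul_nonneg hk.le (by linarith))
  have hcr : Real.cosh (k * r) ≤ Real.cosh (k * dist (p 0) z) := by
    rw [Real.cosh_le_cosh, abs_of_nonneg (by positivity), abs_of_nonneg (by positivity)]
    exact mul_le_mul_of_nonneg_left h0z hk.le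
  have hcR : Real.cosh (k * dist (p d) z) ≤ Real.cosh (k * R) := by
    rw [Real.cosh_le_cosh, abs_of_nonneg (by positivity), abs_of_nonneg (by positivity)]
    exact mul_le_mul_of_nonneg_left hdz hk.le
  have h1 := mul_le_mul_of_nonneg_left hcr hSR
  have h2 := mul_le_mul_of_nonneg_left hcR hSl
  have hadd : Real.sinh (k * (r + σ)) = Real.sinh (k * d) * Real.cosh (k * R) +
      Real.cosh (k * d) * Real.sinh (k * R) := by
    rw [← Real.sinh_add, ← mul_add]; congr 2; linarith
  have hmain : Real.cosh (k * dist (p (r + σ)) z) ≤ Real.cosh (k * R) ^ 2 -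
      Real.sinh (k * R) / Real.sinh (k * d) *
        (Real.cosh (k * r) - Real.cosh (k * d) * Real.cosh (k * R)) := by
    refine le_of_mul_le_mul_left ?_ hSd
    have heq : Real.sinh (k * d) * (Real.cosh (k * R) ^ 2 -
        Real.sinh (k * R) / Real.sinh (k * d) *
          (Real.cosh (k * r) - Real.cosh (k * d) * Real.cosh (k * R))) =
        Real.sinh (k * (r + σ)) * Real.cosh (k * R) - Real.sinh (k * R) * Real.cosh (k * r) := by
      rw [hadd]; field_simp; ring
    rw [heq]
    linarith
  have := le_arcosh_of_cosh_le (by positivity) hmain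
  rw [div_mul_eq_mul_div, le_div_iff₀ hk]
  linarith


/-- diameter estimate for `D(x,y;r,σ)` in spaces of curvature
bounded below. -/
theorem statement2 {E : Type*} [MetricSpace E] (hgeo : IsGeodesicSpace E)
    (κ : ℝ) (hκ : κ < 0) (hcurv : CurvBoundedBelow E κ)
    (x y : E) (r σ : ℝ) (hr : 0 < r) (hy : y ∈ ball x (r / 2)) (hyx : y ≠ x)
    (hσ0 : 0 ≤ σ) (hσ : σ ≤ 2 * dist x y)
    (u : E) (hu : ∃ L, IsGeodesicLine L ∧ x ∈ L ∧ y ∈ L ∧ u ∈ L)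
    (hxu : dist x u = r) (hyu : dist y u = r - dist x y) :
    diam (closedBall y (r - dist x y + σ) \ ball x r) ≤
      Fkappa κ (dist x y) r σ + 2 * σ := by
  obtain ⟨L, hL, hxL, hyL, huL⟩ := hu
  obtain ⟨p, hp, hp0, hpd, hpr⟩ := hL.exists_isometry hxL hyL huL hyx (by linarith)
  have hd : 0 < dist x y := dist_pos.2 hyx.symm
  have hdr : 0 ≤ r - dist x y := hyu ▸ dist_nonneg
  have hRσ : 0 ≤ r - dist x y + σ := by positivity
  rw [hxu] at hpr
  have hvu : dist (p (r + σ)) u = σ := by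
    rw [← hpr, hp.dist_eq, Real.dist_eq, add_sub_cancel_left, abs_of_nonneg hσ0]
  have hbound : ∀ z ∈ closedBall y (r - dist x y + σ) \ ball x r,
      2 * dist (p (r + σ)) z ≤ Fkappa κ (dist x y) r σ := by
    rintro z ⟨hz, hz'⟩
    refine hcurv.two_mul_dist_le_Fkappa hgeo hκ hp hd hr.le hRσ ?_ ?_
    · rw [hpd, dist_comm]; exact mem_closedBall.1 hz
    · rw [hp0, dist_comm]; exact not_lt.1 hz'
  have hu_mem : u ∈ closedBall y (r - dist x y + σ) \ ball x r := by
    refine ⟨?_, ?_⟩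
    · rw [mem_closedBall, dist_comm, hyu]; linarith
    · rw [mem_ball, dist_comm, hxu]; exact lt_irrefl r
  refine diam_le_of_forall_dist_le ?_ fun z hz w hw => ?_
  · linarith [hbound u hu_mem]
  · linarith [hbound z hz, hbound w hw, dist_triangle_left z w (p (r + σ))]
end

section
/- Let E be a geodesic metric space with convex metric and let X be a nonempty, bounded and convex subset of E. Suppose x'∈E is such that dist(x',X) > 0. Then for every y in the closure of co(X ∪ {x'}), dist(y,X) ≤ dist(x',X) − ( dist(x',X) / ( dist(x',X) + diam X ) ) · d(x',y). -/
open Metric Set Filter Bornology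

/-- In a space with convex metric, the distance from a fixed point is a convex function. -/
theorem HasConvexMetric.geodesicConvexFun_dist {E : Type*} [MetricSpace E]
    (hconv : HasConvexMetric E) (x : E) : GeodesicConvexFun (fun y => dist x y) := by
  intro c l hc t ht
  have hx : IsGeodesicPath (fun _ : ℝ => x) 0 := by
    refine ⟨le_rfl, fun s hs r hr => ?_⟩
    rw [Icc_self, mem_singleton_iff] at hs hr
    simp [hs, hr]
  exact hconv _ c 0 l hx hc t ht

/-- In a geodesic space with convex metric, the distance to a nonempty convex set is a convex
function. -/
theorem HasConvexMetric.geodesicConvexFun_infDist {E : Type*} [MetricSpace E]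
    (hconv : HasConvexMetric E) (hgeo : IsGeodesicSpace E) {X : Set E} (hX : X.Nonempty)
    (hXcv : GeodesicConvex X) : GeodesicConvexFun (fun y => infDist y X) := by
  intro c l hc t ht
  refine le_of_forall_pos_le_add fun ε hε => ?_
  obtain ⟨a, ha, hca⟩ := (infDist_lt_iff hX).1 (lt_add_of_pos_right (infDist (c 0) X) hε)
  obtain ⟨b, hb, hcb⟩ := (infDist_lt_iff hX).1 (lt_add_of_pos_right (infDist (c l) X) hε)
  obtain ⟨S, hS⟩ := hgeo a b
  have hSX := hXcv a ha b hb S hS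
  obtain ⟨c', l', hc', rfl, rfl, rfl⟩ := hS
  have hmem : c' (t * l') ∈ X :=
    hSX ⟨t * l', ⟨mul_nonneg ht.1 hc'.1, mul_le_of_le_one_left hc'.1 ht.2⟩, rfl⟩
  have h₀ := mul_le_mul_of_nonneg_left hca.le (sub_nonneg.2 ht.2)
  have h₁ := mul_le_mul_of_nonneg_left hcb.le ht.1
  calc infDist (c (t * l)) X ≤ dist (c (t * l)) (c' (t * l')) := infDist_le_dist_of_mem hmem
    _ ≤ (1 - t) * dist (c 0) (c' 0) + t * dist (c l) (c' l') := hconv c c' l l' hc hc' t ht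
    _ ≤ (1 - t) * infDist (c 0) X + t * infDist (c l) X + ε := by linarith

theorem GeodesicConvexFun.add {E : Type*} [MetricSpace E] {f g : E → ℝ}
    (hf : GeodesicConvexFun f) (hg : GeodesicConvexFun g) :
    GeodesicConvexFun (fun y => f y + g y) := by
  intro c l hc t ht
  linarith [hf c l hc t ht, hg c l hc t ht]

theorem GeodesicConvexFun.const_mul {E : Type*} [MetricSpace E] {f : E → ℝ}
    (hf : GeodesicConvexFun f) {a : ℝ} (ha : 0 ≤ a) :
    GeodesicConvexFun (fun y => a * f y) := by
  intro c l hc t ht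
  linarith [mul_le_mul_of_nonneg_left (hf c l hc t ht) ha]

/-- Sublevel sets of convex functions are convex. -/
theorem GeodesicConvexFun.geodesicConvex_le {E : Type*} [MetricSpace E] {f : E → ℝ}
    (hf : GeodesicConvexFun f) (r : ℝ) : GeodesicConvex {y | f y ≤ r} := by
  rintro _ hx _ hy _ ⟨c, l, hc, rfl, rfl, rfl⟩ _ ⟨s, hs, rfl⟩
  simp only [mem_ofPred_eq] at hx hy ⊢
  rcases hc.1.eq_or_lt with rfl | hl
  · rw [Icc_self, mem_singleton_iff] at hs
    rwa [hs]
  · have ht : s / l ∈ Icc (0 : ℝ) 1 := ⟨div_nonneg hs.1 hl.le, (div_le_one hl).2 hs.2⟩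
    have h := hf c l hc _ ht
    rw [div_mul_cancel₀ s hl.ne'] at h
    linarith [mul_le_mul_of_nonneg_left hx (sub_nonneg.2 ht.2),
      mul_le_mul_of_nonneg_left hy ht.1]

/-- The convex hull is contained in every convex set containing the given set. -/
theorem geodConvexHull_subset {E : Type*} [MetricSpace E] {S C : Set E} (hSC : S ⊆ C)
    (hC : GeodesicConvex C) : geodConvexHull S ⊆ C := by
  refine iUnion_subset fun n => ?_
  induction n with
  | zero => exact hSC
  | succ n ih =>
    rintro z ⟨x, hx, y, hy, T, hT, hz⟩
    exact hC x (ih hx) y (ih hy) T hT hz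

/-- distance estimate on the convex hull of a convex set and a point. -/
theorem statement3 {E : Type*} [MetricSpace E] (hgeo : IsGeodesicSpace E)
    (hconv : HasConvexMetric E) (X : Set E) (hX : X.Nonempty) (hXb : IsBounded X)
    (hXcv : GeodesicConvex X) (x' : E) (hx' : 0 < infDist x' X) :
    ∀ y ∈ closure (geodConvexHull (X ∪ {x'})),
      infDist y X ≤ infDist x' X - infDist x' X / (infDist x' X + diam X) * dist x' y := by
  have hpos : 0 < infDist x' X + diam X := add_pos_of_pos_of_nonneg hx' diam_nonneg
  set α := infDist x' X / (infDist x' X + diam X) with hα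
  have hα₀ : 0 ≤ α := div_nonneg hx'.le hpos.le
  have hf : GeodesicConvexFun (fun y => infDist y X + α * dist x' y) :=
    (hconv.geodesicConvexFun_infDist hgeo hX hXcv).add
      ((hconv.geodesicConvexFun_dist x').const_mul hα₀)
  have hclosed : IsClosed {y | infDist y X + α * dist x' y ≤ infDist x' X} :=
    isClosed_le ((continuous_infDist_pt X).add
      (continuous_const.mul (continuous_const.dist continuous_id))) continuous_const
  have hsub : X ∪ {x'} ⊆ {y | infDist y X + α * dist x' y ≤ infDist x' X} := by
    rintro y (hy | rfl)
    · have hdist : dist x' y ≤ infDist x' X + diam X := by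
        refine le_of_forall_pos_le_add fun ε hε => ?_
        obtain ⟨z, hz, hlt⟩ := (infDist_lt_iff hX).1 (lt_add_of_pos_right (infDist x' X) hε)
        linarith [dist_triangle x' z y, dist_le_diam_of_mem hXb hz hy]
      have h := mul_le_mul_of_nonneg_left hdist hα₀
      rw [hα, div_mul_cancel₀ _ hpos.ne', ← hα] at h
      simpa [infDist_zero_of_mem hy] using h
    · simp
  intro y hy
  exact le_sub_iff_add_le.2
    (closure_minimal (geodConvexHull_subset hsub (hf.geodesicConvex_le _)) hclosed hy)
end
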